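/- Let G=(V,E) be a d-manifold, let F=(f_1,...,f_k):V→ℝ^k be any map and let c∈ℝ^k satisfy c_j∉f_j(V) for every j. Then the level set {F=c} is either the empty graph or a (d−k)-manifold. -/

import Mathlib

open scoped Classical

/-- A finite simple graph: a finite vertex set together with a symmetric, irreflexive
adjacency relation supported on the vertex set. -/
structure FGraph (V : Type) where
  verts : Finset V
  Adj : V → V → Prop
  symm : ∀ {a b}, Adj a b → Adj b a
  loopless : ∀ a, ¬ Adj a a
  mem_of_adj : ∀ {a b}, Adj a b → a ∈ verts

namespace FGraph

variable {V W : Type}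

/-- The subgraph induced on the vertices satisfying `P`. -/
noncomputable def induce (G : FGraph V) (P : V → Prop) : FGraph V where
  verts := G.verts.filter P
  Adj a b := G.Adj a b ∧ P a ∧ P b
  symm h := ⟨G.symm h.1, h.2.2, h.2.1⟩
  loopless a h := G.loopless a h.1
  mem_of_adj h := Finset.mem_filter.mpr ⟨G.mem_of_adj h.1, h.2.1⟩

/-- The unit sphere of a vertex: the subgraph induced on its neighbors. -/
noncomputable def unitSphere (G : FGraph V) (v : V) : FGraph V :=
  G.induce (fun w => G.Adj v w)

/-- The graph with the vertex `v` (and its edges) removed. -/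
noncomputable def erase (G : FGraph V) (v : V) : FGraph V :=
  G.induce (fun w => w ≠ v)

/-- Inductive definition of contractibility: the one-point graph is contractible, and a
graph is contractible if some vertex has a contractible unit sphere and contractible
complement. -/
inductive Contractible : FGraph V → Prop
  | single (G : FGraph V) (v : V) (h : G.verts = {v}) : Contractible G
  | step (G : FGraph V) (v : V) (hv : v ∈ G.verts)
      (h1 : Contractible (G.unitSphere v)) (h2 : Contractible (G.erase v)) :
      Contractible G

mutual
  /-- `G` is a `d`-sphere: the empty graph is the `(-1)`-sphere, and a `d`-manifold is a
  `d`-sphere if removing some vertex renders it contractible. -/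
  inductive IsSphere : ℤ → FGraph V → Prop
    | empty (G : FGraph V) (h : G.verts = ∅) : IsSphere (-1) G
    | punctured (d : ℤ) (G : FGraph V) (hm : IsManifold d G) (v : V) (hv : v ∈ G.verts)
        (hc : Contractible (G.erase v)) : IsSphere d G
  /-- For `d ≥ 0`, `G` is a `d`-manifold iff every unit sphere is a `(d-1)`-sphere. -/
  inductive IsManifold : ℤ → FGraph V → Prop
    | intro (d : ℤ) (hd : 0 ≤ d) (G : FGraph V)
        (h : ∀ v ∈ G.verts, IsSphere (d - 1) (G.unitSphere v)) : IsManifold d G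
end

/-- A simplex of `G`: the vertex set of a complete subgraph. -/
def IsSimplex (G : FGraph V) (x : Finset V) : Prop :=
  x.Nonempty ∧ ↑x ⊆ G.verts ∧ ∀ a ∈ x, ∀ b ∈ x, a ≠ b → G.Adj a b

/-- The Barycentric refinement: vertices are the simplices of `G`, two being adjacent iff
one is strictly contained in the other. -/
noncomputable def barycentric (G : FGraph V) : FGraph (Finset V) where
  verts := G.verts.powerset.filter (fun x => G.IsSimplex x)
  Adj x y := G.IsSimplex x ∧ G.IsSimplex y ∧ (x ⊂ y ∨ y ⊂ x)
  symm h := ⟨h.2.1, h.1, h.2.2.symm⟩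
  loopless x h := by rcases h.2.2 with h' | h' <;> exact (ssubset_irrefl x h')
  mem_of_adj h := Finset.mem_filter.mpr ⟨Finset.mem_powerset.mpr h.1.2.1, h.1⟩

/-- Number of simplices of `G` with exactly `j` vertices (so `numSimplices G (k+1)` is
the `f`-vector entry `f_k(G)`). -/
noncomputable def numSimplices (G : FGraph V) (j : ℕ) : ℕ :=
  (G.verts.powerset.filter (fun x => G.IsSimplex x ∧ x.card = j)).card

/-- Euler characteristic `χ(G) = Σ_{k ≥ 0} (-1)^k f_k(G)`, where `f_k` counts the
simplices with `k+1` vertices. -/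
noncomputable def euler (G : FGraph V) : ℤ :=
  ∑ k ∈ Finset.range G.verts.card, (-1 : ℤ) ^ k * G.numSimplices (k + 1)

/-- The level set `{f = c}`: the subgraph of the Barycentric refinement induced by the
simplices on which `f - c` changes sign. -/
noncomputable def levelSet (G : FGraph V) (f : V → ℝ) (c : ℝ) : FGraph (Finset V) :=
  G.barycentric.induce (fun x => (∃ a ∈ x, f a - c < 0) ∧ (∃ b ∈ x, 0 < f b - c))

/-- Graph isomorphism. -/
def Iso (G : FGraph V) (H : FGraph W) : Prop :=
  ∃ φ : V → W, Set.BijOn φ ↑G.verts ↑H.verts ∧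
    ∀ a ∈ G.verts, ∀ b ∈ G.verts, (G.Adj a b ↔ H.Adj (φ a) (φ b))

/-- Zykov join of two graphs: disjoint union plus all edges between the two parts. -/
noncomputable def join (G : FGraph V) (H : FGraph W) : FGraph (V ⊕ W) where
  verts := G.verts.disjSum H.verts
  Adj a b :=
    match a, b with
    | .inl a, .inl b => G.Adj a b
    | .inr a, .inr b => H.Adj a b
    | .inl a, .inr b => a ∈ G.verts ∧ b ∈ H.verts
    | .inr a, .inl b => b ∈ G.verts ∧ a ∈ H.verts
  symm {a b} h := by
    cases a <;> cases b <;> simp_all <;> first | exact G.symm h | exact H.symm h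
  loopless a h := by
    cases a <;> simp_all <;> first | exact G.loopless _ h | exact H.loopless _ h
  mem_of_adj {a b} h := by
    cases a <;> cases b <;> simp_all [Finset.mem_disjSum] <;>
      first | exact G.mem_of_adj h | exact H.mem_of_adj h

/-- Union of two graphs on the same vertex type. -/
noncomputable def union (G H : FGraph V) : FGraph V where
  verts := G.verts ∪ H.verts
  Adj a b := G.Adj a b ∨ H.Adj a b
  symm h := h.imp G.symm H.symm
  loopless a h := h.elim (G.loopless a) (H.loopless a)
  mem_of_adj h :=
    h.elim (fun h' => Finset.mem_union_left _ (G.mem_of_adj h'))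
      (fun h' => Finset.mem_union_right _ (H.mem_of_adj h'))

/-- A `d`-ball: a graph of the form `S - v` for a `d`-sphere `S` and a vertex `v` of `S`
(up to graph isomorphism). -/
def IsBall (d : ℤ) (H : FGraph W) : Prop :=
  ∃ (S : FGraph ℕ) (v : ℕ), IsSphere d S ∧ v ∈ S.verts ∧ Iso H (S.erase v)

/-- A `d`-manifold with boundary: every unit sphere is a `(d-1)`-sphere or a `(d-1)`-ball. -/
def IsManifoldWithBoundary (d : ℤ) (G : FGraph V) : Prop :=
  ∀ v ∈ G.verts, IsSphere (d - 1) (G.unitSphere v) ∨ IsBall (d - 1) (G.unitSphere v)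

/-- The cyclic graph `C_n` on the vertex set `Fin n`. -/
def cycleGraph (n : ℕ) : FGraph (Fin n) where
  verts := Finset.univ
  Adj a b := a ≠ b ∧ ((a.val + 1) % n = b.val ∨ (b.val + 1) % n = a.val)
  symm h := ⟨h.1.symm, h.2.symm⟩
  loopless a h := h.1 rfl
  mem_of_adj _ := Finset.mem_univ _

/-- `G` is a disjoint union of cyclic graphs `C_n` with `n ≥ 4`: the vertex set splits
into pairwise disjoint pieces, edges never cross between pieces, and each piece induces
a graph isomorphic to a `C_n` with `n ≥ 4`. -/
def IsDisjointUnionOfCycles (G : FGraph V) : Prop :=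
  ∃ P : Finset (Finset V),
    (∀ S ∈ P, ↑S ⊆ G.verts) ∧
    (∀ S ∈ P, ∀ T ∈ P, S ≠ T → Disjoint S T) ∧
    (∀ v ∈ G.verts, ∃ S ∈ P, v ∈ S) ∧
    (∀ a b, G.Adj a b → ∀ S ∈ P, a ∈ S → b ∈ S) ∧
    (∀ S ∈ P, ∃ n, 4 ≤ n ∧ Iso (G.induce (· ∈ S)) (cycleGraph n))

/-- Poincaré–Hopf index `i_f(v) = 1 - χ(S^-_f(v))`. -/
noncomputable def pindex (G : FGraph V) (f : V → ℝ) (v : V) : ℤ :=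
  1 - ((G.unitSphere v).induce (fun w => f w < f v)).euler

/-- Curvature `K(v) = Σ_{k ≥ 0} (-1)^k f_{k-1}(S(v))/(k+1)` with `f_{-1} = 1`. -/
noncomputable def curvature (G : FGraph V) (v : V) : ℝ :=
  ∑ k ∈ Finset.range (G.verts.card + 1),
    (-1 : ℝ) ^ k * (if k = 0 then 1 else ((G.unitSphere v).numSimplices k : ℝ)) / (k + 1)

end FGraph

/-- `sign(a + i b) = sign(a) + i sign(b)`. -/
noncomputable def csgn (z : ℂ) : ℂ :=
  ⟨Real.sign z.re, Real.sign z.im⟩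

/-- The set `U = {1+i, 1-i, -1+i, -1-i}` of possible values of `csgn`. -/
noncomputable def signU : Finset ℂ :=
  {1 + Complex.I, 1 - Complex.I, -1 + Complex.I, -1 - Complex.I}

namespace FGraph

variable {V : Type}

/-- The set of values of `sign(ψ - c)` attained on the finite vertex set `x`. -/
noncomputable def signValues (ψ : V → ℂ) (c : ℂ) (x : Finset V) : Finset ℂ :=
  x.image (fun v => csgn (ψ v - c))

/-- The level set `{ψ = c}` of a complex-valued function: the subgraph of the Barycentric
refinement induced by the simplices on which `sign(ψ - c)` takes at least three distinct
values, including `-1+i` and `1-i`. -/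
noncomputable def complexLevelSet (G : FGraph V) (ψ : V → ℂ) (c : ℂ) : FGraph (Finset V) :=
  G.barycentric.induce (fun x =>
    3 ≤ (signValues ψ c x).card ∧
    (-1 + Complex.I) ∈ signValues ψ c x ∧ (1 - Complex.I) ∈ signValues ψ c x)

/-- The level set `{ψ = 0}_e` for a two-element subset `e ⊆ U`: the subgraph of the
Barycentric refinement induced by the simplices on which `sign(ψ)` attains both values
of `e` and at least three distinct values in total. -/
noncomputable def complexLevelSetE (G : FGraph V) (ψ : V → ℂ) (e : Finset ℂ) :
    FGraph (Finset V) :=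
  G.barycentric.induce (fun x =>
    (∀ u ∈ e, u ∈ signValues ψ 0 x) ∧ 3 ≤ (signValues ψ 0 x).card)

/-- `Ψ^{-1}(t)`: the subgraph of the Barycentric refinement induced by the simplices on
which `sign(ψ)` attains all values of `t`. -/
noncomputable def signPreimage (G : FGraph V) (ψ : V → ℂ) (t : Finset ℂ) :
    FGraph (Finset V) :=
  G.barycentric.induce (fun x => ∀ u ∈ t, u ∈ signValues ψ 0 x)

/-- The sign vectors of `F - c` attained on the finite vertex set `x`. -/
noncomputable def vecSignValues {k : ℕ} (F : V → Fin k → ℝ) (c : Fin k → ℝ)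
    (x : Finset V) : Finset (Fin k → ℝ) :=
  x.image (fun v j => Real.sign (F v j - c j))

/-- The level set `{F = c}` of an `ℝ^k`-valued function: the subgraph of the Barycentric
refinement induced by the simplices on which the sign vector of `F - c` takes at least
`k+1` distinct values, including the `k` vectors `(1,…,1,-1,1,…,1)`. -/
noncomputable def vecLevelSet (G : FGraph V) {k : ℕ} (F : V → Fin k → ℝ) (c : Fin k → ℝ) :
    FGraph (Finset V) :=
  G.barycentric.induce (fun x =>
    k + 1 ≤ (vecSignValues F c x).card ∧
    ∀ j : Fin k, (fun i => if i = j then (-1 : ℝ) else 1) ∈ vecSignValues F c x)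

end FGraph

/-- The complete graph on `Fin n`. -/
def completeFGraph (n : ℕ) : FGraph (Fin n) where
  verts := Finset.univ
  Adj a b := a ≠ b
  symm h := h.symm
  loopless a h := h rfl
  mem_of_adj _ := Finset.mem_univ _

/-- Stirling numbers of the second kind. -/
def stirling2 : ℕ → ℕ → ℕ
  | 0, 0 => 1
  | 0, _ + 1 => 0
  | _ + 1, 0 => 0
  | n + 1, m + 1 => (m + 1) * stirling2 n (m + 1) + stirling2 n m

namespace FGraph

variable {V W : Type}

/-! ### Basic facts about induced subgraphs -/

theorem ext_of_mem {G H : FGraph V} (hv : ∀ a, a ∈ G.verts ↔ a ∈ H.verts)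
    (ha : ∀ a ∈ G.verts, ∀ b ∈ G.verts, (G.Adj a b ↔ H.Adj a b)) : G = H := by
  have h1 : G.verts = H.verts := Finset.ext hv
  have h2 : G.Adj = H.Adj := by
    funext a b
    refine propext ⟨fun h => (ha a (G.mem_of_adj h) b (G.mem_of_adj (G.symm h))).1 h, fun h => ?_⟩
    exact (ha a ((hv a).2 (H.mem_of_adj h)) b ((hv b).2 (H.mem_of_adj (H.symm h)))).2 h
  cases G
  cases H
  subst h1
  subst h2
  rfl

@[simp] theorem mem_induce {G : FGraph V} {P : V → Prop} {a : V} :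
    a ∈ (G.induce P).verts ↔ a ∈ G.verts ∧ P a := by
  simp [induce]

@[simp] theorem induce_adj {G : FGraph V} {P : V → Prop} {a b : V} :
    (G.induce P).Adj a b ↔ G.Adj a b ∧ P a ∧ P b := Iff.rfl

@[simp] theorem mem_unitSphere {G : FGraph V} {v a : V} :
    a ∈ (G.unitSphere v).verts ↔ G.Adj v a := by
  simpa [unitSphere] using fun h => G.mem_of_adj (G.symm h)

@[simp] theorem unitSphere_adj {G : FGraph V} {v a b : V} :
    (G.unitSphere v).Adj a b ↔ G.Adj a b ∧ G.Adj v a ∧ G.Adj v b := Iff.rfl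

@[simp] theorem mem_erase {G : FGraph V} {v a : V} :
    a ∈ (G.erase v).verts ↔ a ∈ G.verts ∧ a ≠ v := by
  simp [erase]

@[simp] theorem erase_adj {G : FGraph V} {v a b : V} :
    (G.erase v).Adj a b ↔ G.Adj a b ∧ a ≠ v ∧ b ≠ v := Iff.rfl

theorem card_unitSphere_lt {G : FGraph V} {v : V} (hv : v ∈ G.verts) :
    (G.unitSphere v).verts.card < G.verts.card := by
  refine Finset.card_lt_card ⟨fun a ha => ?_, fun h => ?_⟩
  · exact G.mem_of_adj (G.symm (mem_unitSphere.1 ha))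
  · exact G.loopless v (mem_unitSphere.1 (h hv))

theorem card_erase_lt {G : FGraph V} {v : V} (hv : v ∈ G.verts) :
    (G.erase v).verts.card < G.verts.card := by
  refine Finset.card_lt_card ⟨fun a ha => (mem_erase.1 ha).1, fun h => ?_⟩
  exact (mem_erase.1 (h hv)).2 rfl

theorem unitSphere_induce {G : FGraph V} {P : V → Prop} {v : V} (hv : P v) :
    (G.induce P).unitSphere v = (G.unitSphere v).induce P := by
  apply ext_of_mem <;> simp <;> tauto

theorem erase_induce (G : FGraph V) (P : V → Prop) (v : V) :
    (G.induce P).erase v = (G.erase v).induce P := by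
  apply ext_of_mem <;> simp <;> tauto

/-! ### Contractibility and spheres -/

/-- A graph with a vertex adjacent to all other vertices is contractible. -/
theorem contractible_of_apex {G : FGraph V} {v : V} (hv : v ∈ G.verts)
    (h : ∀ w ∈ G.verts, w ≠ v → G.Adj v w) : Contractible G := by
  induction hn : G.verts.card using Nat.strong_induction_on generalizing G with
  | _ n ih =>
    subst hn
    by_cases hs : ∃ w ∈ G.verts, w ≠ v
    · obtain ⟨w, hw, hwv⟩ := hs
      refine Contractible.step G w hw
        (ih _ (card_unitSphere_lt hw) (mem_unitSphere.2 (G.symm (h w hw hwv))) ?_ rfl)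
        (ih _ (card_erase_lt hw) (mem_erase.2 ⟨hv, hwv.symm⟩) ?_ rfl)
      · intro u hu huv
        have hu' := mem_unitSphere.1 hu
        exact ⟨h u (G.mem_of_adj (G.symm hu')) huv, G.symm (h w hw hwv), hu'⟩
      · intro u hu huv
        exact ⟨h u (mem_erase.1 hu).1 huv, hwv.symm, (mem_erase.1 hu).2⟩
    · push Not at hs
      exact Contractible.single G v (Finset.eq_singleton_iff_unique_mem.2 ⟨hv, hs⟩)

/-- If every vertex in `P` is adjacent to every vertex outside `P`, so that the graph is the join
of the two parts, and the part `P` is contractible, then the graph is contractible. -/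
theorem Contractible.of_join {A : FGraph V} (hA : Contractible A) {G : FGraph V} {P : V → Prop}
    (hAG : A = G.induce P) (hP : ∀ a ∈ G.verts, ∀ b ∈ G.verts, P a → ¬ P b → G.Adj a b) :
    Contractible G := by
  induction hA generalizing G with
  | single A v hv =>
    subst hAG
    have hm : ∀ w, w ∈ G.verts ∧ P w ↔ w = v := fun w => by
      rw [← mem_induce, hv, Finset.mem_singleton]
    have hv' := (hm v).2 rfl
    refine contractible_of_apex hv'.1 fun w hw hwv => hP v hv'.1 w hw hv'.2 fun hPw => ?_
    exact hwv ((hm w).1 ⟨hw, hPw⟩)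
  | step A v hv _ _ ih1 ih2 =>
    subst hAG
    obtain ⟨hvG, hPv⟩ := mem_induce.1 hv
    refine Contractible.step G v hvG (ih1 (unitSphere_induce hPv) ?_) (ih2 (erase_induce _ _ _) ?_)
    · intro a ha b hb hPa hPb
      rw [mem_unitSphere] at ha hb
      exact ⟨hP a (G.mem_of_adj (G.symm ha)) b (G.mem_of_adj (G.symm hb)) hPa hPb, ha, hb⟩
    · intro a ha b hb hPa hPb
      rw [mem_erase] at ha hb
      exact ⟨hP a ha.1 b hb.1 hPa hPb, ha.2, hb.2⟩

theorem IsManifold.nonneg {d : ℤ} {G : FGraph V} (h : IsManifold d G) : 0 ≤ d := by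
  cases h
  assumption

theorem IsManifold.unitSphere {d : ℤ} {G : FGraph V} (h : IsManifold d G) {v : V}
    (hv : v ∈ G.verts) : IsSphere (d - 1) (G.unitSphere v) := by
  cases h with
  | intro _ _ _ h => exact h v hv

theorem IsSphere.neg_one_le {d : ℤ} {G : FGraph V} (h : IsSphere d G) : -1 ≤ d := by
  cases h with
  | empty => rfl
  | punctured _ _ hm => linarith [hm.nonneg]

theorem IsSphere.isManifold {d : ℤ} {G : FGraph V} (h : IsSphere d G) {v : V}
    (hv : v ∈ G.verts) : IsManifold d G := by
  cases h with
  | empty _ h => simp [h] at hv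
  | punctured _ _ hm => exact hm

theorem induce_eq_self {G : FGraph V} {P : V → Prop} (h : ∀ a ∈ G.verts, P a) :
    G.induce P = G := by
  apply ext_of_mem
  · simpa using h
  · intro a ha b hb
    simpa using fun _ => ⟨(mem_induce.1 ha).2, (mem_induce.1 hb).2⟩

theorem unitSphere_induce_of_adj {G : FGraph V} {P : V → Prop} {v : V}
    (h : ∀ a ∈ G.verts, P a → G.Adj v a) : (G.unitSphere v).induce P = G.induce P := by
  apply ext_of_mem
  · intro b
    simp only [mem_induce, mem_unitSphere]
    exact ⟨fun hb => ⟨G.mem_of_adj (G.symm hb.1), hb.2⟩, fun hb => ⟨h b hb.1 hb.2, hb.2⟩⟩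
  · intro b hb c hc
    simp only [mem_induce, mem_unitSphere] at hb hc
    simp only [induce_adj, unitSphere_adj]
    tauto

/-- The join of a `p`-sphere and a `q`-sphere is a `(p+q+1)`-sphere. -/
theorem IsSphere.of_join {p q : ℤ} {G : FGraph V} {P : V → Prop} (hA : IsSphere p (G.induce P))
    (hB : IsSphere q (G.induce fun a => ¬ P a))
    (hP : ∀ a ∈ G.verts, ∀ b ∈ G.verts, P a → ¬ P b → G.Adj a b) :
    IsSphere (p + q + 1) G := by
  induction hn : G.verts.card using Nat.strong_induction_on generalizing G p q with
  | _ n ih =>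
    subst hn
    cases hA with
    | empty _ h =>
      rw [induce_eq_self] at hB
      · simpa using hB
      · intro a ha hPa
        have := mem_induce.2 ⟨ha, hPa⟩
        simp [h] at this
    | punctured _ _ hAm v hv hc =>
      have hA : IsSphere p (G.induce P) := .punctured _ _ hAm v hv hc
      cases hB with
      | empty _ h =>
        rw [induce_eq_self] at hA
        · simpa using hA
        · intro a ha
          by_contra hPa
          have : a ∈ (G.induce fun a => ¬ P a).verts := mem_induce.2 ⟨ha, hPa⟩
          simp [h] at this
      | punctured _ _ hBm u hu hcB =>
        have hB : IsSphere q (G.induce fun a => ¬ P a) := .punctured _ _ hBm u hu hcB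
        have hp := hAm.nonneg
        have hq := hBm.nonneg
        obtain ⟨hvG, hPv⟩ := mem_induce.1 hv
        refine .punctured _ G (.intro _ (by linarith) G fun w hw => ?_) v hvG
          (hc.of_join (erase_induce _ _ _) ?_)
        · have hJ : ∀ a ∈ (G.unitSphere w).verts, ∀ b ∈ (G.unitSphere w).verts,
              P a → ¬ P b → (G.unitSphere w).Adj a b := by
            intro b hb c hc hPb hPc
            rw [mem_unitSphere] at hb hc
            exact ⟨hP b (G.mem_of_adj (G.symm hb)) c (G.mem_of_adj (G.symm hc)) hPb hPc, hb, hc⟩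
          by_cases hPw : P w
          · have h1 := hAm.unitSphere (mem_induce.2 ⟨hw, hPw⟩)
            rw [unitSphere_induce hPw] at h1
            rw [← unitSphere_induce_of_adj (v := w) fun a ha hPa => hP w hw a ha hPw hPa] at hB
            convert ih _ (card_unitSphere_lt hw) h1 hB hJ rfl using 1
            ring
          · have h1 := hBm.unitSphere (mem_induce.2 ⟨hw, hPw⟩)
            rw [unitSphere_induce (P := fun a => ¬ P a) hPw] at h1
            rw [← unitSphere_induce_of_adj (v := w)
              fun a ha hPa => G.symm (hP a ha w hw hPa hPw)] at hA
            convert ih _ (card_unitSphere_lt hw) hA h1 hJ rfl using 1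
            ring
        · intro a ha b hb hPa hPb
          rw [mem_erase] at ha hb
          exact ⟨hP a ha.1 b hb.1 hPa hPb, ha.2, hb.2⟩

/-- If the vertices in `R` can be removed one after the other, in decreasing order of `r`, each
having a contractible unit sphere when it is removed, and if the remaining graph is contractible,
then so is the whole graph. -/
theorem contractible_of_removal {G : FGraph V} (r : V → ℤ) (R : V → Prop)
    (hR : ∀ v ∈ G.verts, R v → Contractible (G.induce fun w => G.Adj v w ∧ (R w → r w < r v)))
    (hr : ∀ v w, G.Adj v w → r v ≠ r w) (h : Contractible (G.induce fun w => ¬ R w)) :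
    Contractible G := by
  induction hn : G.verts.card using Nat.strong_induction_on generalizing G with
  | _ n ih =>
    subst hn
    by_cases hne : ∃ v ∈ G.verts, R v
    · obtain ⟨v, hv, hmax⟩ := Finset.exists_max_image (G.verts.filter R) r
        (by obtain ⟨v, hv⟩ := hne; exact ⟨v, by simpa using hv⟩)
      rw [Finset.mem_filter] at hv
      have hmax' : ∀ w ∈ G.verts, R w → r w ≤ r v := fun w hw hRw =>
        hmax w (Finset.mem_filter.2 ⟨hw, hRw⟩)
      refine .step G v hv.1 ?_ (ih _ (card_erase_lt hv.1) ?_ (fun a b hab => hr a b hab.1) ?_ rfl)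
      · have key : ∀ w, G.Adj v w → R w → r w < r v := fun w hw hRw =>
          lt_of_le_of_ne (hmax' w (G.mem_of_adj (G.symm hw)) hRw) (hr v w hw).symm
        convert hR v hv.1 hv.2 using 1
        apply ext_of_mem
        · intro w
          simp only [mem_unitSphere, mem_induce]
          exact ⟨fun hw => ⟨G.mem_of_adj (G.symm hw), hw, key w hw⟩, fun hw => hw.2.1⟩
        · intro a ha b hb
          rw [mem_unitSphere] at ha hb
          have := key a ha
          have := key b hb
          simp only [unitSphere_adj, induce_adj]
          tauto
      · intro u hu hRu
        rw [mem_erase] at hu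
        have key : ∀ w, G.Adj u w → (R w → r w < r u) → w ≠ v := by
          rintro w hw hlt rfl
          exact absurd (hlt hv.2) (not_lt.2 (hmax' u hu.1 hRu))
        convert hR u hu.1 hRu using 1
        apply ext_of_mem
        · intro w
          have := key w
          simp only [mem_induce, mem_erase, erase_adj]
          tauto
        · intro a ha b hb
          have := key a
          have := key b
          simp only [mem_induce, mem_erase, erase_adj, induce_adj] at ha hb ⊢
          tauto
      · rw [← erase_induce]
        convert h using 1
        apply induce_eq_self
        rintro a ha rfl
        exact (mem_induce.1 ha).2 hv.2
    · rwa [induce_eq_self fun a ha hRa => hne ⟨a, ha, hRa⟩] at h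

/-! ### Invariance under isomorphism -/

theorem Iso.induce_of {G : FGraph V} {H : FGraph W} {φ : V → W}
    (hφ : Set.BijOn φ ↑G.verts ↑H.verts)
    (hadj : ∀ a ∈ G.verts, ∀ b ∈ G.verts, (G.Adj a b ↔ H.Adj (φ a) (φ b)))
    {P : V → Prop} {Q : W → Prop} (hPQ : ∀ a ∈ G.verts, (P a ↔ Q (φ a))) :
    Iso (G.induce P) (H.induce Q) := by
  refine ⟨φ, ⟨fun a ha => ?_, fun a ha b hb hab => ?_, fun b hb => ?_⟩, fun a ha b hb => ?_⟩
  · simp only [Finset.mem_coe, mem_induce] at ha ⊢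
    exact ⟨hφ.mapsTo ha.1, (hPQ a ha.1).1 ha.2⟩
  · simp only [Finset.mem_coe, mem_induce] at ha hb
    exact hφ.injOn ha.1 hb.1 hab
  · simp only [Finset.mem_coe, mem_induce] at hb
    obtain ⟨a, ha, rfl⟩ := hφ.surjOn hb.1
    exact ⟨a, by simpa using ⟨ha, (hPQ a ha).2 hb.2⟩, rfl⟩
  · rw [mem_induce] at ha hb
    rw [induce_adj, induce_adj, hadj a ha.1 b hb.1, hPQ a ha.1, hPQ b hb.1]

theorem Iso.unitSphere_of {G : FGraph V} {H : FGraph W} {φ : V → W}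
    (hφ : Set.BijOn φ ↑G.verts ↑H.verts)
    (hadj : ∀ a ∈ G.verts, ∀ b ∈ G.verts, (G.Adj a b ↔ H.Adj (φ a) (φ b)))
    {v : V} (hv : v ∈ G.verts) : Iso (G.unitSphere v) (H.unitSphere (φ v)) :=
  Iso.induce_of hφ hadj fun a ha => hadj v hv a ha

theorem Iso.erase_of {G : FGraph V} {H : FGraph W} {φ : V → W}
    (hφ : Set.BijOn φ ↑G.verts ↑H.verts)
    (hadj : ∀ a ∈ G.verts, ∀ b ∈ G.verts, (G.Adj a b ↔ H.Adj (φ a) (φ b)))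
    {v : V} (hv : v ∈ G.verts) : Iso (G.erase v) (H.erase (φ v)) :=
  Iso.induce_of hφ hadj fun _ ha => (hφ.injOn.ne_iff ha hv).symm

theorem Contractible.of_iso {G : FGraph V} (hG : Contractible G) {H : FGraph W}
    (h : Iso G H) : Contractible H := by
  induction hG generalizing H with
  | single G v hv =>
    obtain ⟨φ, hφ, -⟩ := h
    refine .single H (φ v) (Finset.coe_injective ?_)
    rw [← hφ.image_eq, hv]
    simp
  | step G v hv _ _ ih1 ih2 =>
    obtain ⟨φ, hφ, hadj⟩ := h
    exact .step H (φ v) (hφ.mapsTo hv) (ih1 (Iso.unitSphere_of hφ hadj hv))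
      (ih2 (Iso.erase_of hφ hadj hv))

theorem IsSphere.of_iso {d : ℤ} {G : FGraph V} (hG : IsSphere d G) {H : FGraph W}
    (h : Iso G H) : IsSphere d H := by
  induction hn : G.verts.card using Nat.strong_induction_on generalizing d G H with
  | _ n ih =>
    subst hn
    obtain ⟨φ, hφ, hadj⟩ := h
    cases hG with
    | empty _ h =>
      refine .empty H (Finset.coe_injective ?_)
      rw [← hφ.image_eq, h]
      simp
    | punctured _ _ hm v hv hc =>
      refine .punctured d H (.intro _ hm.nonneg H fun w hw => ?_) (φ v) (hφ.mapsTo hv)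
        (hc.of_iso (Iso.erase_of hφ hadj hv))
      obtain ⟨a, ha, rfl⟩ := hφ.surjOn hw
      exact ih _ (card_unitSphere_lt ha) (hm.unitSphere ha) (Iso.unitSphere_of hφ hadj ha) rfl

/-! ### Inclusion graphs of families of finite sets -/

/-- The graph on a family of finite sets, two sets being adjacent iff one is strictly contained
in the other. -/
def inclGraph (A : Finset (Finset V)) : FGraph (Finset V) where
  verts := A
  Adj x y := x ∈ A ∧ y ∈ A ∧ (x ⊂ y ∨ y ⊂ x)
  symm h := ⟨h.2.1, h.1, h.2.2.symm⟩
  loopless x h := by rcases h.2.2 with h' | h' <;> exact (ssubset_irrefl x h')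
  mem_of_adj h := h.1

@[simp] theorem inclGraph_verts {A : Finset (Finset V)} : (inclGraph A).verts = A := rfl

@[simp] theorem inclGraph_adj {A : Finset (Finset V)} {x y : Finset V} :
    (inclGraph A).Adj x y ↔ x ∈ A ∧ y ∈ A ∧ (x ⊂ y ∨ y ⊂ x) := Iff.rfl

theorem induce_inclGraph {A B : Finset (Finset V)} {P : Finset V → Prop}
    (h : ∀ x, x ∈ B ↔ x ∈ A ∧ P x) : (inclGraph A).induce P = inclGraph B := by
  apply ext_of_mem
  · simp [h]
  · intro x _ y _
    simp only [induce_adj, inclGraph_adj, h]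
    tauto

theorem erase_inclGraph (A : Finset (Finset V)) (x : Finset V) :
    (inclGraph A).erase x = inclGraph (A.erase x) :=
  induce_inclGraph fun y => by rw [Finset.mem_erase]; tauto

theorem contractible_inclGraph_of_apex {A : Finset (Finset V)} {x : Finset V} (hx : x ∈ A)
    (h : ∀ y ∈ A, x ⊆ y ∨ y ⊆ x) : Contractible (inclGraph A) := by
  refine contractible_of_apex (v := x) hx fun y hy hyx => ⟨hx, hy, ?_⟩
  exact (h y hy).imp (fun h => h.ssubset_of_ne hyx.symm) (fun h => h.ssubset_of_ne hyx)

/-- Sets in `R` can be removed from a family, in decreasing order of size, provided each of them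
has a contractible unit sphere when it is removed. -/
theorem contractible_inclGraph_of_removal {A : Finset (Finset V)} (R : Finset V → Prop)
    (hR : ∀ x ∈ A, R x →
      Contractible (inclGraph (A.filter fun y => y ⊂ x ∨ x ⊂ y ∧ ¬ R y)))
    (h : Contractible (inclGraph (A.filter fun x => ¬ R x))) : Contractible (inclGraph A) := by
  refine contractible_of_removal (fun x => (x.card : ℤ)) R (fun x hx hRx => ?_) ?_ ?_
  · convert hR x hx hRx using 1
    refine induce_inclGraph fun y => ?_
    have h1 : y ⊂ x → y.card < x.card := Finset.card_lt_card
    have h2 : x ⊂ y → ¬ y.card < x.card := fun h => (Finset.card_lt_card h).not_gt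
    simp only [Finset.mem_filter, inclGraph_adj, Nat.cast_lt]
    tauto
  · rintro x y ⟨-, -, h | h⟩
    · exact_mod_cast (Finset.card_lt_card h).ne
    · exact_mod_cast (Finset.card_lt_card h).ne'
  · rwa [induce_inclGraph (B := A.filter fun x => ¬ R x) (by simp)]

/-- Sets in `R` can be removed from a family, in increasing order of size, provided each of them
has a contractible unit sphere when it is removed. -/
theorem contractible_inclGraph_of_removal' {A : Finset (Finset V)} (R : Finset V → Prop)
    (hR : ∀ x ∈ A, R x →
      Contractible (inclGraph (A.filter fun y => x ⊂ y ∨ y ⊂ x ∧ ¬ R y)))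
    (h : Contractible (inclGraph (A.filter fun x => ¬ R x))) : Contractible (inclGraph A) := by
  refine contractible_of_removal (fun x => -(x.card : ℤ)) R (fun x hx hRx => ?_) ?_ ?_
  · convert hR x hx hRx using 1
    refine induce_inclGraph fun y => ?_
    have h1 : x ⊂ y → x.card < y.card := Finset.card_lt_card
    have h2 : y ⊂ x → ¬ x.card < y.card := fun h => (Finset.card_lt_card h).not_gt
    simp only [Finset.mem_filter, inclGraph_adj, neg_lt_neg_iff, Nat.cast_lt]
    tauto
  · rintro x y ⟨-, -, h | h⟩
    · exact_mod_cast neg_injective.ne (by exact_mod_cast (Finset.card_lt_card h).ne)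
    · exact_mod_cast neg_injective.ne (by exact_mod_cast (Finset.card_lt_card h).ne')
  · rwa [induce_inclGraph (B := A.filter fun x => ¬ R x) (by simp)]

/-- If a family is closed under adding the set `b`, then it can be retracted to the members
containing `b`. -/
theorem contractible_inclGraph_of_union {A : Finset (Finset V)} (b : Finset V)
    (hb : ∀ x ∈ A, x ∪ b ∈ A) (h : Contractible (inclGraph (A.filter fun x => b ⊆ x))) :
    Contractible (inclGraph A) := by
  refine contractible_inclGraph_of_removal (fun x => ¬ b ⊆ x) (fun x hx hbx => ?_) (by simpa)
  have hss : x ⊂ x ∪ b :=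
    ⟨Finset.subset_union_left, fun h => hbx (Finset.subset_union_right.trans h)⟩
  refine contractible_inclGraph_of_apex (x := x ∪ b) ?_ fun y hy => ?_
  · simp only [Finset.mem_filter, not_not]
    exact ⟨hb x hx, Or.inr ⟨hss, Finset.subset_union_right⟩⟩
  · simp only [Finset.mem_filter, not_not] at hy
    rcases hy.2 with h1 | ⟨h1, h2⟩
    · exact Or.inr (h1.subset.trans hss.subset)
    · exact Or.inl (Finset.union_subset h1.subset h2)

/-- The unit sphere of `x` in an inclusion graph is the join of the members strictly below `x`
and those strictly above. -/
theorem isSphere_unitSphere_inclGraph {A B C : Finset (Finset V)} {x : Finset V} (hx : x ∈ A)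
    {p q : ℤ} (hB : ∀ y, y ∈ B ↔ y ∈ A ∧ y ⊂ x) (hC : ∀ y, y ∈ C ↔ y ∈ A ∧ x ⊂ y)
    (hp : IsSphere p (inclGraph B)) (hq : IsSphere q (inclGraph C)) :
    IsSphere (p + q + 1) ((inclGraph A).unitSphere x) := by
  have hS : (inclGraph A).unitSphere x = inclGraph (A.filter fun y => y ⊂ x ∨ x ⊂ y) := by
    refine induce_inclGraph fun y => ?_
    simp only [Finset.mem_filter, inclGraph_adj]
    tauto
  rw [hS]
  have hasymm : ∀ y, x ⊂ y → ¬ y ⊂ x := fun y h h' => ssubset_irrefl _ (h.trans h')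
  refine IsSphere.of_join (P := fun y => y ⊂ x) ?_ ?_ ?_
  · rwa [induce_inclGraph (B := B)]
    intro y
    simp only [Finset.mem_filter, hB]
    tauto
  · rwa [induce_inclGraph (B := C)]
    intro y
    have := hasymm y
    simp only [Finset.mem_filter, hC]
    tauto
  · intro y hy z hz hyx hzx
    refine ⟨hy, hz, Or.inl (hyx.trans ?_)⟩
    simp only [inclGraph_verts, Finset.mem_filter] at hz
    tauto

theorem inclGraph_iso_of_union {A B : Finset (Finset V)} (b : Finset V)
    (hA : ∀ x ∈ A, Disjoint x b) (hB : ∀ y, y ∈ B ↔ b ⊆ y ∧ y \ b ∈ A) :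
    Iso (inclGraph A) (inclGraph B) := by
  have hsd : ∀ x ∈ A, (x ∪ b) \ b = x := fun x hx => by
    rw [Finset.union_sdiff_right, Finset.sdiff_eq_self_of_disjoint (hA x hx)]
  have hmem : ∀ x ∈ A, x ∪ b ∈ B := fun x hx =>
    (hB _).2 ⟨Finset.subset_union_right, by rwa [hsd x hx]⟩
  have hsub : ∀ x ∈ A, ∀ y, x ∪ b ⊆ y ∪ b ↔ x ⊆ y := fun x hx y =>
    ⟨fun h a ha => ((Finset.mem_union.1 (h (Finset.mem_union_left _ ha))).resolve_right
      (Finset.disjoint_left.1 (hA x hx) ha)), fun h => Finset.union_subset_union_left h⟩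
  refine ⟨fun x => x ∪ b, ⟨hmem, fun x hx y hy hxy => ?_, fun y hy => ?_⟩, fun x hx y hy => ?_⟩
  · rw [← hsd x hx, ← hsd y hy]
    exact congrArg (· \ b) hxy
  · obtain ⟨h1, h2⟩ := (hB y).1 hy
    exact ⟨y \ b, h2, Finset.sdiff_union_of_subset h1⟩
  · rw [inclGraph_verts] at hx hy
    simp only [inclGraph_adj, Finset.ssubset_def, hsub x hx, hsub y hy, hx, hy, hmem x hx,
      hmem y hy]

/-! ### Boundaries of products of simplices -/

/-- The proper subsets of `x` on which all the labels occurring in `x` occur. -/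
noncomputable def labelledFaces {L : Type} (ℓ : V → L) (x : Finset V) : Finset (Finset V) :=
  x.powerset.filter fun y => y ⊂ x ∧ y.image ℓ = x.image ℓ

theorem mem_labelledFaces {L : Type} {ℓ : V → L} {x y : Finset V} :
    y ∈ labelledFaces ℓ x ↔ y ⊂ x ∧ y.image ℓ = x.image ℓ := by
  simp only [labelledFaces, Finset.mem_filter, Finset.mem_powerset, and_iff_right_iff_imp]
  exact fun h => h.1.subset

theorem image_eq_of_subset {L : Type} {ℓ : V → L} {x y z : Finset V} (h : y.image ℓ = x.image ℓ)
    (hyz : y ⊆ z) (hzx : z ⊆ x) : z.image ℓ = x.image ℓ :=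
  (Finset.image_subset_image hzx).antisymm (h ▸ Finset.image_subset_image hyz)

theorem sdiff_ssubset_sdiff_iff {x y z : Finset V} (hz : y ⊆ z) (hx : y ⊆ x) :
    z \ y ⊂ x \ y ↔ z ⊂ x := by
  have key : ∀ {s t : Finset V}, y ⊆ t → (s \ y ⊆ t \ y ↔ s ⊆ t) := fun ht => by
    rw [Finset.subset_sdiff, and_iff_left Finset.sdiff_disjoint, sdiff_le_iff,
      Finset.sup_eq_union, Finset.union_eq_right.2 ht]
  rw [Finset.ssubset_def, Finset.ssubset_def, key hx, key hz]

/-- The labelled faces containing a fixed element of a label class with at least two elements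
form a contractible graph. -/
theorem contractible_labelledFaces_mem {L : Type} (ℓ : V → L) {x : Finset V} {a a' : V}
    (ha : a ∈ x) (ha' : a' ∈ x) (hne : a' ≠ a) (hl : ℓ a' = ℓ a) :
    Contractible (inclGraph ((labelledFaces ℓ x).filter fun y => a ∈ y)) := by
  induction hn : x.card using Nat.strong_induction_on generalizing x with
  | _ n ih =>
    subst hn
    set A := x.filter fun z => ℓ z = ℓ a ∧ z ≠ a with hA
    have hA' : ∀ z, z ∈ A ↔ z ∈ x ∧ ℓ z = ℓ a ∧ z ≠ a := by simp [hA]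
    have ha'A : a' ∈ A := (hA' a').2 ⟨ha', hl, hne⟩
    have haA : a ∈ x \ A := Finset.mem_sdiff.2 ⟨ha, fun h => ((hA' a).1 h).2.2 rfl⟩
    have himg : (x \ A).image ℓ = x.image ℓ := by
      refine (Finset.image_subset_image Finset.sdiff_subset).antisymm fun b hb => ?_
      obtain ⟨z, hz, rfl⟩ := Finset.mem_image.1 hb
      by_cases hzA : z ∈ A
      · rw [((hA' z).1 hzA).2.1]
        exact Finset.mem_image_of_mem _ haA
      · exact Finset.mem_image_of_mem _ (Finset.mem_sdiff.2 ⟨hz, hzA⟩)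
    have hAx : A ⊆ x := Finset.filter_subset _ _
    refine contractible_inclGraph_of_removal (fun y => A ⊆ y) (fun y hy hAy => ?_) ?_
    · simp only [Finset.mem_filter, mem_labelledFaces] at hy
      obtain ⟨⟨hyx, hyi⟩, hay⟩ := hy
      convert ih _ (Finset.card_lt_card hyx) hay (hAy ha'A) rfl using 2
      ext w
      simp only [Finset.mem_filter, mem_labelledFaces, hyi]
      have h1 : w ⊂ y → w ⊂ x := fun h => h.trans hyx
      have h2 : y ⊂ w → A ⊆ w := fun h => hAy.trans h.subset
      tauto
    · refine contractible_inclGraph_of_union (x \ A) (fun y hy => ?_) ?_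
      · simp only [Finset.mem_filter, mem_labelledFaces] at hy ⊢
        obtain ⟨⟨⟨hyx, hyi⟩, hay⟩, hAy⟩ := hy
        have hsub : y ∪ x \ A ⊆ x := Finset.union_subset hyx.subset Finset.sdiff_subset
        have hn : ¬ A ⊆ y ∪ x \ A := fun h => hAy fun z hz =>
          (Finset.mem_union.1 (h hz)).resolve_right fun h' => (Finset.mem_sdiff.1 h').2 hz
        exact ⟨⟨⟨⟨hsub, fun h => hn (hAx.trans h)⟩,
          image_eq_of_subset hyi Finset.subset_union_left hsub⟩, Finset.mem_union_left _ hay⟩, hn⟩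
      · refine contractible_inclGraph_of_apex (x := x \ A) ?_ fun y hy => ?_
        · simp only [Finset.mem_filter, mem_labelledFaces]
          have hn : ¬ A ⊆ x \ A := fun h => (Finset.mem_sdiff.1 (h ha'A)).2 ha'A
          exact ⟨⟨⟨⟨⟨Finset.sdiff_subset, fun h => hn (hAx.trans h)⟩, himg⟩, haA⟩, hn⟩, subset_rfl⟩
        · exact Or.inl (Finset.mem_filter.1 hy).2

/-- The proper subsets of `x` on which all labels of `x` occur form a sphere. -/
theorem isSphere_labelledFaces {L : Type} (ℓ : V → L) (x : Finset V) :
    IsSphere ((x.card : ℤ) - (x.image ℓ).card - 1) (inclGraph (labelledFaces ℓ x)) := by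
  induction hn : x.card using Nat.strong_induction_on generalizing x L with
  | _ n ih =>
    subst hn
    by_cases hinj : Set.InjOn ℓ x
    · rw [Finset.card_image_of_injOn hinj, sub_self, zero_sub]
      refine .empty _ (Finset.eq_empty_of_forall_notMem fun y hy => ?_)
      rw [inclGraph_verts, mem_labelledFaces] at hy
      obtain ⟨b, hb, hby⟩ := Finset.exists_of_ssubset hy.1
      have : ℓ b ∈ y.image ℓ := hy.2 ▸ Finset.mem_image_of_mem _ hb
      obtain ⟨c, hc, hcb⟩ := Finset.mem_image.1 this
      exact hby (hinj (hy.1.subset hc) hb hcb ▸ hc)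
    · have hlt : (x.image ℓ).card < x.card := by
        refine lt_of_le_of_ne Finset.card_image_le fun h => hinj (Finset.card_image_iff.1 h)
      simp only [Set.InjOn, Finset.mem_coe] at hinj
      push Not at hinj
      obtain ⟨a', ha', a, ha, hl, hne⟩ := hinj
      have hfacet : x.erase a ∈ labelledFaces ℓ x := by
        refine mem_labelledFaces.2 ⟨Finset.erase_ssubset ha, ?_⟩
        refine (Finset.image_subset_image (Finset.erase_subset _ _)).antisymm fun b hb => ?_
        obtain ⟨z, hz, rfl⟩ := Finset.mem_image.1 hb
        by_cases hza : z = a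
        · rw [hza, ← hl]
          exact Finset.mem_image_of_mem _ (Finset.mem_erase.2 ⟨hne, ha'⟩)
        · exact Finset.mem_image_of_mem _ (Finset.mem_erase.2 ⟨hza, hz⟩)
      refine .punctured _ _ (.intro _ (by omega) _
        fun y (hy : y ∈ labelledFaces ℓ x) => ?_) (x.erase a) hfacet ?_
      · obtain ⟨hyx, hyi⟩ := mem_labelledFaces.1 hy
        have hyne : y.Nonempty := by
          rw [← Finset.image_nonempty (f := ℓ), hyi, Finset.image_nonempty]
          exact ⟨a, ha⟩
        have hcard := Finset.card_sdiff_add_card_eq_card hyx.subset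
        have hsne : (x \ y).Nonempty := Finset.sdiff_nonempty.2 hyx.not_subset
        have h1 := ih _ (Finset.card_lt_card hyx) ℓ y rfl
        have h2 := ih (x \ y).card (by have := hyne.card_pos; omega) (fun _ => ℓ a) (x \ y) rfl
        have hunit : ((x \ y).image fun _ => ℓ a).card = 1 := by
          rw [Finset.image_const hsne, Finset.card_singleton]
        have h3 : Iso (inclGraph (labelledFaces (fun _ => ℓ a) (x \ y)))
            (inclGraph ((labelledFaces ℓ x).filter fun z => y ⊂ z)) := by
          refine inclGraph_iso_of_union y (fun z hz => ?_) fun z => ?_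
          · exact Finset.disjoint_of_subset_left (mem_labelledFaces.1 hz).1.subset
              Finset.sdiff_disjoint
          · simp only [Finset.mem_filter, mem_labelledFaces]
            constructor
            · rintro ⟨⟨hzx, -⟩, hyz⟩
              refine ⟨hyz.subset, (sdiff_ssubset_sdiff_iff hyz.subset hyx.subset).2 hzx, ?_⟩
              rw [Finset.image_const hsne,
                Finset.image_const (Finset.sdiff_nonempty.2 hyz.not_subset)]
            · rintro ⟨hyz, hzx, hi⟩
              rw [sdiff_ssubset_sdiff_iff hyz hyx.subset] at hzx
              refine ⟨⟨hzx, image_eq_of_subset hyi hyz hzx.subset⟩, hyz, fun h => ?_⟩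
              rw [Finset.sdiff_eq_empty_iff_subset.2 h, Finset.image_const hsne] at hi
              simp at hi
        convert isSphere_unitSphere_inclGraph hy (fun z => ?_) (fun z => Finset.mem_filter) h1
          (h2.of_iso h3) using 1
        · rw [hunit, hyi]
          push_cast [← hcard]
          ring
        · simp only [mem_labelledFaces, hyi]
          have : z ⊂ y → z ⊂ x := fun h => h.trans hyx
          tauto
      · rw [erase_inclGraph]
        refine contractible_inclGraph_of_union {a} (fun y hy => ?_) ?_
        · simp only [Finset.mem_erase, mem_labelledFaces] at hy ⊢
          obtain ⟨hy1, hyx, hyi⟩ := hy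
          have hsub : y ∪ {a} ⊆ x := Finset.union_subset hyx.subset (by simpa using ha)
          refine ⟨fun h => ?_, ⟨hsub, fun h => hy1 ?_⟩,
            image_eq_of_subset hyi Finset.subset_union_left hsub⟩
          · have : a ∈ y ∪ {a} := by simp
            simp [h] at this
          · refine subset_antisymm (Finset.subset_erase.2 ⟨hyx.subset, fun hay => ?_⟩)
              fun z hz => ?_
            · exact hyx.not_subset (h.trans (Finset.union_subset subset_rfl (by simpa using hay)))
            · have := h (Finset.mem_of_mem_erase hz)
              have := Finset.ne_of_mem_erase hz
              simp_all
        · convert contractible_labelledFaces_mem ℓ ha ha' hne hl using 2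
          ext y
          simp only [Finset.mem_filter, Finset.mem_erase, Finset.singleton_subset_iff]
          have : a ∈ y → y ≠ x.erase a := by rintro h rfl; simp at h
          tauto

/-! ### Simplices and links -/

/-- The simplices of a graph. -/
noncomputable def simplices (G : FGraph V) : Finset (Finset V) := G.barycentric.verts

theorem mem_simplices {G : FGraph V} {x : Finset V} : x ∈ G.simplices ↔ G.IsSimplex x := by
  simp only [simplices, barycentric, Finset.mem_filter, Finset.mem_powerset, and_iff_right_iff_imp]
  exact fun h => h.2.1

theorem barycentric_eq_inclGraph (G : FGraph V) : G.barycentric = inclGraph G.simplices := by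
  apply ext_of_mem
  · exact fun _ => Iff.rfl
  · intro x _ y _
    rw [inclGraph_adj, mem_simplices, mem_simplices]
    rfl

theorem IsSimplex.mono {G : FGraph V} {x y : Finset V} (h : G.IsSimplex x) (hy : y.Nonempty)
    (hyx : y ⊆ x) : G.IsSimplex y :=
  ⟨hy, hyx.trans h.2.1, fun a ha b hb => h.2.2 a (hyx ha) b (hyx hb)⟩

theorem isSimplex_singleton {G : FGraph V} {v : V} (hv : v ∈ G.verts) : G.IsSimplex {v} := by
  refine ⟨Finset.singleton_nonempty v, Finset.singleton_subset_iff.2 hv, fun a ha b hb hab => ?_⟩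
  simp_all

/-- The link of `x`: the subgraph induced on the vertices adjacent to all vertices in `x`. -/
noncomputable def link (G : FGraph V) (x : Finset V) : FGraph V :=
  G.induce fun w => ∀ a ∈ x, G.Adj a w

theorem link_empty (G : FGraph V) : G.link ∅ = G :=
  induce_eq_self (by simp)

theorem link_insert {G : FGraph V} {a : V} {x : Finset V} (hx : ∀ b ∈ x, G.Adj a b) :
    G.link (insert a x) = (G.unitSphere a).link x := by
  have key : ∀ w, (∀ b ∈ insert a x, G.Adj b w) ↔
      G.Adj a w ∧ ∀ b ∈ x, (G.unitSphere a).Adj b w := fun w => by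
    rw [Finset.forall_mem_insert]
    refine and_congr_right fun haw => forall₂_congr fun b hb => ?_
    simp [haw, hx b hb]
  apply ext_of_mem
  · intro w
    have h1 : G.Adj a w → w ∈ G.verts := fun h => G.mem_of_adj (G.symm h)
    simp only [link, mem_induce, mem_unitSphere, key]
    tauto
  · intro v _ w _
    simp only [link, induce_adj, key]
    rw [unitSphere_adj (a := v)]
    tauto

theorem link_singleton (G : FGraph V) (a : V) : G.link {a} = G.unitSphere a := by
  rw [← insert_empty_eq, link_insert (by simp), link_empty]

theorem card_link_lt {G : FGraph V} {x : Finset V} (hx : G.IsSimplex x) :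
    (G.link x).verts.card < G.verts.card := by
  obtain ⟨a, ha⟩ := hx.1
  refine Finset.card_lt_card ⟨fun w hw => (mem_induce.1 hw).1, fun h => ?_⟩
  exact G.loopless a ((mem_induce.1 (h (hx.2.1 ha))).2 a ha)

theorem IsSphere.link {d : ℤ} {G : FGraph V} (hG : IsSphere d G) {x : Finset V}
    (hx : x ⊆ G.verts) (hadj : ∀ a ∈ x, ∀ b ∈ x, a ≠ b → G.Adj a b) :
    IsSphere (d - x.card) (G.link x) := by
  induction x using Finset.induction_on generalizing d G with
  | empty => simpa [link_empty] using hG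
  | insert a x hax ih =>
    have ha := hx (Finset.mem_insert_self a x)
    have hax' : ∀ b ∈ x, G.Adj a b := fun b hb =>
      hadj a (Finset.mem_insert_self a x) b (Finset.mem_insert_of_mem hb)
        (by rintro rfl; exact hax hb)
    rw [link_insert hax', Finset.card_insert_of_notMem hax]
    convert ih ((hG.isManifold ha).unitSphere ha) (fun b hb => mem_unitSphere.2 (hax' b hb))
      (fun b hb c hc hbc => ⟨hadj b (Finset.mem_insert_of_mem hb) c
        (Finset.mem_insert_of_mem hc) hbc, hax' b hb, hax' c hc⟩) using 1
    push_cast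
    ring

/-- In a `d`-manifold, the link of a simplex with `n` vertices is a `(d-n)`-sphere. -/
theorem IsManifold.link {d : ℤ} {G : FGraph V} (hG : IsManifold d G) {x : Finset V}
    (hx : G.IsSimplex x) : IsSphere (d - x.card) (G.link x) := by
  obtain ⟨a, ha⟩ := hx.1
  have hax : ∀ b ∈ x.erase a, G.Adj a b := fun b hb =>
    hx.2.2 a ha b (Finset.mem_of_mem_erase hb) (Finset.ne_of_mem_erase hb).symm
  rw [← Finset.insert_erase ha, link_insert hax, Finset.card_insert_of_notMem (by simp)]
  convert (hG.unitSphere (hx.2.1 ha)).link (x := x.erase a)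
    (fun b hb => mem_unitSphere.2 (hax b hb))
    (fun b hb c hc hbc => ⟨hx.2.2 b (Finset.mem_of_mem_erase hb) c (Finset.mem_of_mem_erase hc) hbc,
      hax b hb, hax c hc⟩) using 1
  push_cast
  ring

theorem simplices_link_iso {G : FGraph V} {x : Finset V} (hx : G.IsSimplex x) :
    Iso (inclGraph (G.link x).simplices) (inclGraph (G.simplices.filter fun y => x ⊂ y)) := by
  refine inclGraph_iso_of_union x (fun s hs => ?_) fun y => ?_
  · refine Finset.disjoint_left.2 fun a ha hax => ?_
    exact G.loopless a ((mem_induce.1 ((mem_simplices.1 hs).2.1 ha)).2 a hax)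
  · rw [Finset.mem_filter, mem_simplices, mem_simplices]
    constructor
    · rintro ⟨hy, hxy⟩
      have hl : ∀ w ∈ y \ x, ∀ a ∈ x, G.Adj a w := fun w hw a ha => by
        rw [Finset.mem_sdiff] at hw
        exact hy.2.2 a (hxy.subset ha) w hw.1 (by rintro rfl; exact hw.2 ha)
      refine ⟨hxy.subset, Finset.sdiff_nonempty.2 hxy.not_subset, fun w hw => ?_,
        fun a ha b hb hab => ?_⟩
      · exact mem_induce.2 ⟨hy.2.1 (Finset.mem_sdiff.1 hw).1, hl w hw⟩
      · exact ⟨hy.2.2 a (Finset.mem_sdiff.1 ha).1 b (Finset.mem_sdiff.1 hb).1 hab, hl a ha, hl b hb⟩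
    · rintro ⟨hxy, hne, hsub, hadj⟩
      have hl : ∀ w ∈ y, w ∉ x → w ∈ G.verts ∧ ∀ a ∈ x, G.Adj a w := fun w hw hwx =>
        mem_induce.1 (hsub (Finset.mem_sdiff.2 ⟨hw, hwx⟩))
      refine ⟨⟨hne.mono Finset.sdiff_subset, fun w hw => ?_, fun a ha b hb hab => ?_⟩,
        hxy, Finset.sdiff_nonempty.1 hne⟩
      · by_cases hwx : w ∈ x
        · exact hx.2.1 hwx
        · exact (hl w hw hwx).1
      · by_cases hax : a ∈ x <;> by_cases hbx : b ∈ x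
        · exact hx.2.2 a hax b hbx hab
        · exact (hl b hb hbx).2 a hax
        · exact G.symm ((hl a ha hax).2 b hbx)
        · exact (hadj a (Finset.mem_sdiff.2 ⟨ha, hax⟩) b (Finset.mem_sdiff.2 ⟨hb, hbx⟩) hab).1

/-! ### Barycentric refinements -/

theorem contractible_simplices_erase {G : FGraph V} {v : V}
    (h : Contractible (inclGraph (G.erase v).simplices)) :
    Contractible (inclGraph (G.simplices.erase {v})) := by
  refine contractible_inclGraph_of_removal' (fun x => v ∈ x) (fun x hx hvx => ?_) ?_
  · rw [Finset.mem_erase, mem_simplices] at hx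
    have hne : (x.erase v).Nonempty := by
      rw [Finset.nonempty_iff_ne_empty, Ne, Finset.erase_eq_empty_iff]
      rintro (h | h)
      · simp [h] at hvx
      · exact hx.1 h
    refine contractible_inclGraph_of_apex (x := x.erase v) ?_ fun y hy => ?_
    · simp only [Finset.mem_filter, Finset.mem_erase, mem_simplices]
      refine ⟨⟨fun h => ?_, hx.2.mono hne (Finset.erase_subset _ _)⟩,
        Or.inr ⟨Finset.erase_ssubset hvx, by simp⟩⟩
      have : v ∈ x.erase v := by simp [h]
      simp at this
    · simp only [Finset.mem_filter] at hy
      rcases hy.2 with h | ⟨h, hvy⟩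
      · exact Or.inl ((Finset.erase_subset _ _).trans h.subset)
      · exact Or.inr (Finset.subset_erase.2 ⟨h.subset, hvy⟩)
  · convert h using 2
    ext x
    simp only [Finset.mem_filter, Finset.mem_erase, mem_simplices]
    constructor
    · rintro ⟨⟨-, hx⟩, hvx⟩
      have hne : ∀ a ∈ x, a ≠ v := by rintro a ha rfl; exact hvx ha
      exact ⟨hx.1, fun a ha => mem_erase.2 ⟨hx.2.1 ha, hne a ha⟩,
        fun a ha b hb hab => ⟨hx.2.2 a ha b hb hab, hne a ha, hne b hb⟩⟩
    · intro hx
      have hvx : v ∉ x := fun h => (mem_erase.1 (hx.2.1 h)).2 rfl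
      exact ⟨⟨by rintro rfl; simp at hvx, hx.1, fun a ha => (mem_erase.1 (hx.2.1 ha)).1,
        fun a ha b hb hab => (hx.2.2 a ha b hb hab).1⟩, hvx⟩

/-- The Barycentric refinement of a contractible graph is contractible. -/
theorem Contractible.simplices {G : FGraph V} (hG : Contractible G) :
    Contractible (inclGraph G.simplices) := by
  induction hG with
  | single G v hv =>
    have hvG : v ∈ G.verts := by simp [hv]
    refine contractible_inclGraph_of_apex (mem_simplices.2 (isSimplex_singleton hvG))
      fun y hy => Or.inr ?_
    rw [← hv]
    exact (mem_simplices.1 hy).2.1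
  | step G v hv _ _ ih1 ih2 =>
    refine .step _ {v} (mem_simplices.2 (isSimplex_singleton hv)) ?_ ?_
    · rw [← link_singleton] at ih1
      convert ih1.of_iso (simplices_link_iso (isSimplex_singleton hv)) using 1
      refine induce_inclGraph fun y => ?_
      have h1 : G.IsSimplex y → ¬ y ⊂ {v} := fun hy h =>
        hy.1.ne_empty (Finset.ssubset_singleton_iff.1 h)
      have h2 := isSimplex_singleton hv
      simp only [Finset.mem_filter, inclGraph_adj, mem_simplices]
      tauto
    · rw [erase_inclGraph]
      exact contractible_simplices_erase ih2

/-- In the family of simplices carrying all labels, the unit spheres are spheres, provided the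
Barycentric refinements of links are. -/
theorem isSphere_unitSphere_of_labels {L : Type} [Fintype L] [Nonempty L] (ℓ : V → L)
    {G : FGraph V} {d : ℤ} {A : Finset (Finset V)}
    (hA : ∀ x, x ∈ A ↔ G.IsSimplex x ∧ ∀ t, ∃ v ∈ x, ℓ v = t) {x : Finset V} (hx : x ∈ A)
    (hG : IsSphere (d - x.card) (inclGraph (G.link x).simplices)) :
    IsSphere (d - Fintype.card L) ((inclGraph A).unitSphere x) := by
  obtain ⟨hxs, hxl⟩ := (hA x).1 hx
  have huniv : x.image ℓ = Finset.univ := Finset.eq_univ_of_forall fun t =>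
    Finset.mem_image.2 (hxl t)
  convert isSphere_unitSphere_inclGraph hx (fun y => ?_) (fun y => ?_)
    (isSphere_labelledFaces ℓ x) (hG.of_iso (simplices_link_iso hxs)) using 1
  · rw [huniv, Finset.card_univ]
    ring
  · rw [mem_labelledFaces, huniv, Finset.eq_univ_iff_forall, hA]
    simp only [Finset.mem_image]
    constructor
    · rintro ⟨hyx, hyl⟩
      obtain ⟨a, ha, -⟩ := hyl (Classical.arbitrary L)
      exact ⟨⟨hxs.mono ⟨a, ha⟩ hyx.subset, hyl⟩, hyx⟩
    · exact fun h => ⟨h.2, h.1.2⟩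
  · rw [Finset.mem_filter, mem_simplices, hA, and_assoc]
    refine and_congr_right fun _ => (and_iff_right_of_imp fun hxy t => ?_).symm
    obtain ⟨v, hv, hvt⟩ := hxl t
    exact ⟨v, hxy.subset hv, hvt⟩

/-- The Barycentric refinement of a `d`-sphere is a `d`-sphere. -/
theorem IsSphere.simplices {d : ℤ} {G : FGraph V} (hG : IsSphere d G) :
    IsSphere d (inclGraph G.simplices) := by
  induction hn : G.verts.card using Nat.strong_induction_on generalizing d G with
  | _ n ih =>
    subst hn
    cases hG with
    | empty _ h =>
      refine .empty _ (Finset.eq_empty_of_forall_notMem fun x hx => ?_)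
      obtain ⟨⟨a, ha⟩, hx, -⟩ := mem_simplices.1 hx
      have := hx ha
      simp [h] at this
    | punctured _ _ hm v hv hc =>
      refine .punctured _ _ (.intro _ hm.nonneg _ fun x (hx : x ∈ G.simplices) => ?_) {v}
        (mem_simplices.2 (isSimplex_singleton hv)) ?_
      · have hx' := mem_simplices.1 hx
        convert isSphere_unitSphere_of_labels (fun _ => ()) (fun y => ?_) hx
          (ih _ (card_link_lt hx') (hm.link hx') rfl) using 1
        · simp
        · rw [mem_simplices, iff_self_and]
          rintro ⟨⟨a, ha⟩, -⟩ t
          exact ⟨a, ha, rfl⟩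
      · rw [erase_inclGraph]
        exact contractible_simplices_erase hc.simplices

/-! ### Level sets -/

/-- The simplices carrying all labels of an arbitrary labelling of the vertices of a `d`-manifold
by `k + 1` labels form a `(d-k)`-manifold, unless there are none. -/
theorem IsManifold.of_labels {L : Type} [Fintype L] [Nonempty L] (ℓ : V → L) {G : FGraph V} {d : ℤ}
    (hG : IsManifold d G) {A : Finset (Finset V)}
    (hA : ∀ x, x ∈ A ↔ G.IsSimplex x ∧ ∀ t, ∃ v ∈ x, ℓ v = t) (hne : A.Nonempty) :
    IsManifold (d + 1 - Fintype.card L) (inclGraph A) := by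
  have h : ∀ x ∈ A, IsSphere (d - Fintype.card L) ((inclGraph A).unitSphere x) := fun x hx =>
    isSphere_unitSphere_of_labels ℓ hA hx (hG.link ((hA x).1 hx).1).simplices
  obtain ⟨x, hx⟩ := hne
  have := (h x hx).neg_one_le
  refine .intro _ (by linarith) _ fun y hy => ?_
  convert h y hy using 1
  ring

/-- The label of a point: the index `j` if the point is the `j`-th distinguished value `e j`, and
`none` if it is not distinguished. -/
noncomputable def valueLabel {k : ℕ} {X : Type} (e : Fin k → X) (p : X) : Option (Fin k) :=
  if h : ∃ j, e j = p then some h.choose else none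

theorem valueLabel_eq_some {k : ℕ} {X : Type} {e : Fin k → X} (he : Function.Injective e) {p : X}
    {j : Fin k} : valueLabel e p = some j ↔ p = e j := by
  unfold valueLabel
  split_ifs with h
  · rw [Option.some_inj]
    exact ⟨fun hj => by rw [← hj, h.choose_spec], fun hp => he (h.choose_spec.trans hp)⟩
  · simp only [false_iff]
    exact fun hp => h ⟨j, hp.symm⟩

theorem valueLabel_eq_none {k : ℕ} {X : Type} {e : Fin k → X} {p : X} :
    valueLabel e p = none ↔ ∀ j, e j ≠ p := by
  unfold valueLabel
  split_ifs with h
  · simpa using h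
  · simpa using h

/-- A finite set contains all `k` distinguished values and has at least `k + 1` elements iff all
labels occur. -/
theorem valueLabel_surjective_iff {k : ℕ} {X : Type} {e : Fin k → X} (he : Function.Injective e)
    (S : Finset X) :
    (k + 1 ≤ S.card ∧ ∀ j, e j ∈ S) ↔ ∀ t, ∃ p ∈ S, valueLabel e p = t := by
  have hcard : (Finset.univ.image e).card = k := by
    rw [Finset.card_image_of_injective _ he, Finset.card_univ, Fintype.card_fin]
  constructor
  · rintro ⟨hS, hj⟩ (_ | j)
    · obtain ⟨p, hp, hpe⟩ := Finset.exists_mem_notMem_of_card_lt_card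
        (show (Finset.univ.image e).card < S.card by omega)
      exact ⟨p, hp, valueLabel_eq_none.2 (by simpa using hpe)⟩
    · exact ⟨e j, hj j, (valueLabel_eq_some he).2 rfl⟩
  · intro h
    have hj : ∀ j, e j ∈ S := fun j => by
      obtain ⟨p, hp, hpj⟩ := h (some j)
      rwa [← (valueLabel_eq_some he).1 hpj]
    obtain ⟨p, hp, hpn⟩ := h none
    refine ⟨?_, hj⟩
    have hp' : p ∉ Finset.univ.image e := by simpa using valueLabel_eq_none.1 hpn
    have hsub : insert p (Finset.univ.image e) ⊆ S := by
      refine Finset.insert_subset hp fun q hq => ?_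
      obtain ⟨j, -, rfl⟩ := Finset.mem_image.1 hq
      exact hj j
    have := Finset.card_le_card hsub
    rwa [Finset.card_insert_of_notMem hp', hcard] at this

theorem vecLevelSet_eq_inclGraph (G : FGraph V) {k : ℕ} (F : V → Fin k → ℝ) (c : Fin k → ℝ) :
    G.vecLevelSet F c = inclGraph (G.vecLevelSet F c).verts := by
  unfold vecLevelSet
  rw [barycentric_eq_inclGraph]
  exact induce_inclGraph fun x => mem_induce

end FGraph

/-- Discrete Morse–Sard for `k` functions. If `G` is a `d`-manifold,
`F = (f_1,…,f_k) : V → ℝ^k` is any map and `c ∈ ℝ^k` satisfies `c_j ∉ f_j(V)` for every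
`j`, then the level set `{F = c}` is either the empty graph or a `(d-k)`-manifold. -/
theorem morse_sard_k_functions {V : Type} (G : FGraph V) (d : ℤ)
    (hG : FGraph.IsManifold d G) (k : ℕ) (F : V → Fin k → ℝ) (c : Fin k → ℝ)
    (hc : ∀ j : Fin k, ∀ v ∈ G.verts, F v j ≠ c j) :
    (G.vecLevelSet F c).verts = ∅ ∨
      FGraph.IsManifold (d - k) (G.vecLevelSet F c) := by
  have he : Function.Injective fun j i : Fin k => if i = j then (-1 : ℝ) else 1 := by
    intro j j' h
    by_contra hne
    have := congrFun h j
    norm_num [hne] at this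
  refine or_iff_not_imp_left.2 fun hne => ?_
  rw [FGraph.vecLevelSet_eq_inclGraph]
  convert hG.of_labels (L := Option (Fin k))
    (fun v => FGraph.valueLabel (fun j i : Fin k => if i = j then (-1 : ℝ) else 1)
      fun j => Real.sign (F v j - c j))
    (fun x => ?_) (Finset.nonempty_iff_ne_empty.2 hne) using 1
  · rw [Fintype.card_option, Fintype.card_fin]
    push_cast
    ring
  · have := FGraph.valueLabel_surjective_iff he (FGraph.vecSignValues F c x)
    unfold FGraph.vecLevelSet
    rw [FGraph.mem_induce, this]
    refine and_congr FGraph.mem_simplices (forall_congr' fun t => ?_)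
    simp [FGraph.vecSignValues]
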